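/- Let n > 2 be a natural number and let x₁,…,xₙ > 0 be such that not all the x_i are equal. Then the posterior obtained from the Jeffreys prior π₂(α,η) = √((ρ+1)Ψ(ρ) − ρ)/α², with ρ = η²/α², is proper; that is, ∫₀^∞ ∫₀^∞ [√((η²/α² + 1)Ψ(η²/α²) − η²/α²)/α^{2n+2}] · ∏_{i=1}^n [x_i I₀(η x_i/α²)] · exp(−∑_{i=1}^n (x_i² + η²)/(2α²)) dη dα < ∞. -/

import Mathlib

open MeasureTheory Filter Set

/-- The modified Bessel function of the first kind of order 0:
`I₀(x) = ∑ (x/2)^(2m) / (m!)²`. -/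
noncomputable def besselI0 (x : ℝ) : ℝ :=
  ∑' m : ℕ, (x / 2) ^ (2 * m) / ((Nat.factorial m : ℝ)) ^ 2

/-- The modified Bessel function of the first kind of order 1:
`I₁(x) = ∑ (x/2)^(2m+1) / (m!·(m+1)!)`. -/
noncomputable def besselI1 (x : ℝ) : ℝ :=
  ∑' m : ℕ, (x / 2) ^ (2 * m + 1) / ((Nat.factorial m : ℝ) * (Nat.factorial (m + 1) : ℝ))

/-- `Ψ(ρ) = ∫₀^∞ (y³/ρ²) exp(−y²/(2ρ) − ρ/2) I₁(y)²/I₀(y) dy − ρ`. -/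
noncomputable def PsiRice (ρ : ℝ) : ℝ :=
  (∫ y in Set.Ioi (0 : ℝ),
      (y ^ 3 / ρ ^ 2) * Real.exp (-(y ^ 2) / (2 * ρ) - ρ / 2) * (besselI1 y) ^ 2 / besselI0 y)
    - ρ

lemma besselI0_term_le (x : ℝ) (m : ℕ) :
    (x / 2) ^ (2 * m) / ((Nat.factorial m : ℝ)) ^ 2 ≤
      x ^ (2 * m) / (Nat.factorial (2 * m) : ℝ) := by
  have h : (Nat.factorial (2 * m) : ℝ) ≤ 4 ^ m * (Nat.factorial m : ℝ) ^ 2 := by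
    have h1 := Nat.choose_mul_factorial_mul_factorial (show m ≤ 2 * m by lia)
    have h2 := Nat.centralBinom_le_four_pow m
    rw [Nat.centralBinom_eq_two_mul_choose] at h2
    rw [show 2 * m - m = m by lia] at h1
    have h3 : Nat.factorial (2 * m) ≤ 4 ^ m * Nat.factorial m ^ 2 := by
      rw [← h1, mul_assoc, ← sq]
      gcongr
    exact_mod_cast h3
  have hx : 0 ≤ x ^ (2 * m) := by rw [pow_mul]; positivity
  rw [div_pow, div_div, pow_mul 2 2 m]
  norm_num only
  gcongr

lemma besselI0_term_nonneg (x : ℝ) (m : ℕ) :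
    0 ≤ (x / 2) ^ (2 * m) / ((Nat.factorial m : ℝ)) ^ 2 := by
  rw [pow_mul]
  positivity

lemma summable_besselI0 (x : ℝ) :
    Summable fun m : ℕ => (x / 2) ^ (2 * m) / ((Nat.factorial m : ℝ)) ^ 2 :=
  (Real.hasSum_cosh x).summable.of_nonneg_of_le (besselI0_term_nonneg x) (besselI0_term_le x)

lemma besselI0_nonneg (x : ℝ) : 0 ≤ besselI0 x :=
  tsum_nonneg (besselI0_term_nonneg x)

lemma besselI0_le_exp {x : ℝ} (hx : 0 ≤ x) : besselI0 x ≤ Real.exp x := by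
  calc besselI0 x ≤ Real.cosh x := by
        rw [Real.cosh_eq_tsum]
        exact (summable_besselI0 x).tsum_le_tsum (besselI0_term_le x)
          (Real.hasSum_cosh x).summable
    _ ≤ Real.exp x := by
        rw [Real.cosh_eq]
        have : Real.exp (-x) ≤ Real.exp x := Real.exp_le_exp.2 (by linarith)
        linarith

lemma besselI1_nonneg {x : ℝ} (hx : 0 ≤ x) : 0 ≤ besselI1 x :=
  tsum_nonneg fun m => by positivity

lemma besselI1_le_besselI0 {x : ℝ} (hx : 0 ≤ x) : besselI1 x ≤ besselI0 x := by
  set a : ℕ → ℝ := fun m => (x / 2) ^ (2 * m) / ((Nat.factorial m : ℝ)) ^ 2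
  have hs : Summable a := summable_besselI0 x
  have hs' : Summable fun m => a (m + 1) := (summable_nat_add_iff 1).2 hs
  have hle : ∀ m : ℕ, (x / 2) ^ (2 * m + 1) /
      ((Nat.factorial m : ℝ) * (Nat.factorial (m + 1) : ℝ)) ≤ (a m + a (m + 1)) / 2 := by
    intro m
    have h := two_mul_le_add_sq ((x / 2) ^ m / (Nat.factorial m : ℝ))
      ((x / 2) ^ (m + 1) / (Nat.factorial (m + 1) : ℝ))
    have e1 : (x / 2) ^ (2 * m + 1) / ((Nat.factorial m : ℝ) * (Nat.factorial (m + 1) : ℝ)) =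
        (x / 2) ^ m / (Nat.factorial m : ℝ) *
          ((x / 2) ^ (m + 1) / (Nat.factorial (m + 1) : ℝ)) := by
      rw [div_mul_div_comm, ← pow_add]
      congr 2
      ring
    have e2 : ∀ k, a k = ((x / 2) ^ k / (Nat.factorial k : ℝ)) ^ 2 := by
      intro k
      rw [div_pow, ← pow_mul, mul_comm k 2]
    rw [e1, e2, e2]
    linarith
  have hsum : Summable fun m => (a m + a (m + 1)) / 2 := (hs.add hs').div_const 2
  calc besselI1 x ≤ ∑' m, (a m + a (m + 1)) / 2 :=
        (hsum.of_nonneg_of_le (fun m => by positivity) hle).tsum_le_tsum hle hsum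
    _ = (∑' m, a m + ∑' m, a (m + 1)) / 2 := by rw [tsum_div_const, hs.tsum_add hs']
    _ ≤ ∑' m, a m := by
        have h0 : 0 ≤ a 0 := besselI0_term_nonneg x 0
        have := hs.tsum_eq_zero_add
        linarith
    _ = besselI0 x := rfl

lemma besselI1_sq_div_besselI0_le_exp {x : ℝ} (hx : 0 ≤ x) :
    besselI1 x ^ 2 / besselI0 x ≤ Real.exp x := by
  refine (div_le_of_le_mul₀ (besselI0_nonneg x) (besselI0_nonneg x) ?_).trans (besselI0_le_exp hx)
  rw [← sq]
  exact pow_le_pow_left₀ (besselI1_nonneg hx) (besselI1_le_besselI0 hx) 2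

lemma exists_one_add_pow_le_exp_sq (k : ℕ) {c : ℝ} (hc : 0 < c) :
    ∃ K : ℝ, 0 < K ∧ ∀ t : ℝ, 0 ≤ t → (1 + t) ^ k ≤ K * Real.exp (c * t ^ 2) := by
  refine ⟨Nat.factorial k * Real.exp (1 + 1 / (4 * c)), by positivity, fun t ht => ?_⟩
  have h1 := Real.pow_div_factorial_le_exp (1 + t) (by positivity) k
  rw [div_le_iff₀ (by positivity), mul_comm] at h1
  refine h1.trans ?_
  rw [mul_assoc, ← Real.exp_add]
  refine mul_le_mul_of_nonneg_left (Real.exp_le_exp.2 ?_) (by positivity)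
  have : 1 / (4 * c) + c * t ^ 2 - t = (2 * c * t - 1) ^ 2 / (4 * c) := by
    field_simp
    ring
  have h2 : 0 ≤ (2 * c * t - 1) ^ 2 / (4 * c) := by positivity
  linarith

lemma integrable_gaussian_shift {b : ℝ} (hb : 0 < b) (m : ℝ) :
    Integrable fun y : ℝ => Real.exp (-b * (y - m) ^ 2) :=
  (integrable_exp_neg_mul_sq hb).comp_sub_right m

lemma integral_gaussian_shift (b m : ℝ) :
    ∫ y : ℝ, Real.exp (-b * (y - m) ^ 2) = √(Real.pi / b) := by
  rw [integral_sub_right_eq_self (fun y : ℝ => Real.exp (-b * y ^ 2)) m, integral_gaussian]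

lemma exists_PsiRice_sq_le :
    ∃ K : ℝ, 0 < K ∧ ∀ s : ℝ, 0 < s → PsiRice (s ^ 2) ≤ K * (1 + s) ^ 3 := by
  obtain ⟨C, hC, hCb⟩ := exists_one_add_pow_le_exp_sq 3 (show (0 : ℝ) < 1 / 4 by norm_num)
  refine ⟨C * √(Real.pi * 4), by positivity, fun s hs => ?_⟩
  set b : ℝ := 1 / (4 * s ^ 2) with hb
  have hb0 : 0 < b := by positivity
  set A : ℝ := C * (1 + s) ^ 3 / s with hA
  have hA0 : 0 < A := by positivity
  have hint : Integrable fun y : ℝ => A * Real.exp (-b * (y - s ^ 2) ^ 2) :=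
    (integrable_gaussian_shift hb0 _).const_mul _
  have hpt : ∀ y ∈ Ioi (0 : ℝ), (y ^ 3 / (s ^ 2) ^ 2) *
      Real.exp (-(y ^ 2) / (2 * s ^ 2) - s ^ 2 / 2) * (besselI1 y) ^ 2 / besselI0 y ≤
      A * Real.exp (-b * (y - s ^ 2) ^ 2) := by
    intro y hy
    have hy : 0 < y := hy
    set t : ℝ := |y - s ^ 2| / s with ht
    have ht0 : 0 ≤ t := by positivity
    have hyt : y ≤ s * (1 + s) * (1 + t) := by
      have h1 : y - s ^ 2 ≤ s * t := by
        rw [ht, mul_div_cancel₀ _ hs.ne']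
        exact le_abs_self _
      nlinarith [mul_nonneg hs.le ht0, mul_nonneg (mul_nonneg hs.le hs.le) ht0]
    have ht2 : t ^ 2 = (y - s ^ 2) ^ 2 / s ^ 2 := by rw [ht, div_pow, sq_abs]
    have hexp : Real.exp (-(y ^ 2) / (2 * s ^ 2) - s ^ 2 / 2) * Real.exp y =
        Real.exp (-(1 / 4 * t ^ 2)) * Real.exp (-b * (y - s ^ 2) ^ 2) := by
      rw [← Real.exp_add, ← Real.exp_add, ht2, hb]
      congr 1
      field_simp
      ring
    calc _ = (y ^ 3 / (s ^ 2) ^ 2) * Real.exp (-(y ^ 2) / (2 * s ^ 2) - s ^ 2 / 2) *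
          ((besselI1 y) ^ 2 / besselI0 y) := by rw [mul_div_assoc]
      _ ≤ (y ^ 3 / (s ^ 2) ^ 2) * Real.exp (-(y ^ 2) / (2 * s ^ 2) - s ^ 2 / 2) *
          Real.exp y := by
        gcongr
        exact besselI1_sq_div_besselI0_le_exp hy.le
      _ = (y ^ 3 / (s ^ 2) ^ 2) *
          (Real.exp (-(1 / 4 * t ^ 2)) * Real.exp (-b * (y - s ^ 2) ^ 2)) := by
        rw [mul_assoc, hexp]
      _ ≤ ((s * (1 + s)) ^ 3 * (C * Real.exp (1 / 4 * t ^ 2)) / (s ^ 2) ^ 2) *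
          (Real.exp (-(1 / 4 * t ^ 2)) * Real.exp (-b * (y - s ^ 2) ^ 2)) := by
        gcongr
        calc y ^ 3 ≤ (s * (1 + s) * (1 + t)) ^ 3 := by gcongr
          _ = (s * (1 + s)) ^ 3 * (1 + t) ^ 3 := mul_pow _ _ _
          _ ≤ _ := by gcongr; exact hCb t ht0
      _ = A * Real.exp (-b * (y - s ^ 2) ^ 2) := by
        rw [Real.exp_neg, hA]
        field_simp
  have hle : PsiRice (s ^ 2) ≤ A * √(Real.pi / b) - s ^ 2 := by
    unfold PsiRice
    gcongr
    refine (integral_mono_of_nonneg ?_ hint.integrableOn ?_).trans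
      ((setIntegral_le_integral hint (Eventually.of_forall fun y => by positivity)).trans ?_)
    · refine (ae_restrict_iff' measurableSet_Ioi).2 (Eventually.of_forall fun y hy => ?_)
      have hy : 0 < y := hy
      have := besselI0_nonneg y
      simp only [Pi.zero_apply]
      positivity
    · exact (ae_restrict_iff' measurableSet_Ioi).2 (Eventually.of_forall hpt)
    · rw [integral_const_mul, integral_gaussian_shift]
  have hsq : √(Real.pi / b) = √(Real.pi * 4) * s := by
    rw [hb, ← Real.sqrt_sq hs.le, ← Real.sqrt_mul (by positivity), Real.sq_sqrt (by positivity)]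
    congr 1
    field_simp
  have : A * √(Real.pi / b) = C * √(Real.pi * 4) * (1 + s) ^ 3 := by
    rw [hsq, hA]
    field_simp
  nlinarith [sq_nonneg s]

lemma exists_sqrt_PsiRice_le :
    ∃ K : ℝ, 0 < K ∧ ∀ s : ℝ, 0 < s →
      √((s ^ 2 + 1) * PsiRice (s ^ 2) - s ^ 2) ≤ K * (1 + s) ^ 3 := by
  obtain ⟨K, hK, hKb⟩ := exists_PsiRice_sq_le
  refine ⟨√K, by positivity, fun s hs => Real.sqrt_le_iff.2 ⟨by positivity, ?_⟩⟩
  have h1 : (s ^ 2 + 1) * PsiRice (s ^ 2) ≤ (1 + s) ^ 3 * (K * (1 + s) ^ 3) := by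
    refine (mul_le_mul_of_nonneg_left (hKb s hs) (by positivity)).trans ?_
    gcongr
    nlinarith [pow_pos hs 2, pow_pos hs 3]
  rw [mul_pow, Real.sq_sqrt hK.le]
  nlinarith [sq_nonneg s]

lemma prod_mul_besselI0_le {n : ℕ} {x : Fin n → ℝ} (hx : ∀ i, 0 < x i) {η α : ℝ} (hη : 0 < η) :
    ∏ i, x i * besselI0 (η * x i / α ^ 2) ≤
      (∏ i, x i) * Real.exp (∑ i, η * x i / α ^ 2) := by
  rw [Real.exp_sum, ← Finset.prod_mul_distrib]
  refine Finset.prod_le_prod (fun i _ => mul_nonneg (hx i).le (besselI0_nonneg _)) fun i _ => ?_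
  have := hx i
  gcongr
  exact besselI0_le_exp (by positivity)

lemma sum_sub_sq_ge {n : ℕ} (x : Fin n → ℝ) {i j : Fin n} (hij : i ≠ j) (η : ℝ) :
    (x i - x j) ^ 2 / 2 + 2 * (η - (x i + x j) / 2) ^ 2 ≤ ∑ k, (x k - η) ^ 2 := by
  calc _ = ∑ k ∈ {i, j}, (x k - η) ^ 2 := by rw [Finset.sum_pair hij]; ring
    _ ≤ _ := Finset.sum_le_sum_of_subset_of_nonneg (Finset.subset_univ _)
        fun _ _ _ => sq_nonneg _

lemma exists_inv_pow_mul_exp_le (n : ℕ) (hn : 0 < n) {c : ℝ} (hc : 0 < c) :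
    ∃ K : ℝ, 0 < K ∧ ∀ α : ℝ, 0 < α →
      (1 + α⁻¹) ^ 3 * α⁻¹ ^ (2 * n + 1) * Real.exp (-(c * α⁻¹ ^ 2)) ≤ K * (1 + α ^ 2)⁻¹ := by
  obtain ⟨K, hK, hKb⟩ := exists_one_add_pow_le_exp_sq (2 * n + 4) hc
  refine ⟨2 * K, by positivity, fun α hα => ?_⟩
  set v := α⁻¹ with hv
  have hv0 : 0 < v := by positivity
  have hvα : v * α = 1 := inv_mul_cancel₀ hα.ne'
  rw [← div_eq_mul_inv, le_div_iff₀ (by positivity), Real.exp_neg]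
  have h1 : v ^ (2 * n + 1) * (1 + α ^ 2) ≤ 2 * (1 + v) ^ (2 * n + 1) := by
    obtain ⟨k, rfl⟩ : ∃ k, n = k + 1 := ⟨n - 1, by lia⟩
    have e : v ^ (2 * (k + 1) + 1) * (1 + α ^ 2) =
        v ^ (2 * (k + 1) + 1) + v ^ (2 * k + 1) * (v * α) ^ 2 := by ring
    have h2 : v ^ (2 * (k + 1) + 1) ≤ (1 + v) ^ (2 * (k + 1) + 1) := by gcongr; linarith
    have h3 : v ^ (2 * k + 1) ≤ (1 + v) ^ (2 * (k + 1) + 1) := by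
      calc v ^ (2 * k + 1) ≤ (1 + v) ^ (2 * k + 1) := by gcongr; linarith
        _ ≤ _ := pow_le_pow_right₀ (by linarith) (by lia)
    rw [e, hvα, one_pow, mul_one]
    linarith
  calc (1 + v) ^ 3 * v ^ (2 * n + 1) * (Real.exp (c * v ^ 2))⁻¹ * (1 + α ^ 2)
      = (1 + v) ^ 3 * (v ^ (2 * n + 1) * (1 + α ^ 2)) * (Real.exp (c * v ^ 2))⁻¹ := by ring
    _ ≤ (1 + v) ^ 3 * (2 * (1 + v) ^ (2 * n + 1)) * (Real.exp (c * v ^ 2))⁻¹ := by gcongr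
    _ = 2 * (1 + v) ^ (2 * n + 4) * (Real.exp (c * v ^ 2))⁻¹ := by ring
    _ ≤ 2 * (K * Real.exp (c * v ^ 2)) * (Real.exp (c * v ^ 2))⁻¹ := by
        gcongr
        exact hKb v hv0.le
    _ = 2 * K := by field_simp

lemma exists_posterior_le {n : ℕ} (hn : 0 < n) {x : Fin n → ℝ} (hx : ∀ i, 0 < x i)
    {i j : Fin n} (hij : x i ≠ x j) :
    ∃ K : ℝ, 0 < K ∧ ∀ α : ℝ, 0 < α → ∀ η : ℝ, 0 < η →
      √((η ^ 2 / α ^ 2 + 1) * PsiRice (η ^ 2 / α ^ 2) - η ^ 2 / α ^ 2) / α ^ (2 * n + 2) *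
          (∏ i, x i * besselI0 (η * x i / α ^ 2)) *
          Real.exp (-(∑ i, (x i ^ 2 + η ^ 2) / (2 * α ^ 2))) ≤
        K * (1 + α ^ 2)⁻¹ * α⁻¹ *
          Real.exp (-(1 / (2 * α ^ 2)) * (η - (x i + x j) / 2) ^ 2) := by
  set m : ℝ := (x i + x j) / 2 with hm
  have hm0 : 0 < m := by have := hx i; have := hx j; positivity
  set c : ℝ := (x i - x j) ^ 2 / 4 with hc
  have hc0 : 0 < c := by have := sub_ne_zero.2 hij; positivity
  obtain ⟨K₁, hK₁, hK₁b⟩ := exists_sqrt_PsiRice_le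
  obtain ⟨K₂, hK₂, hK₂b⟩ := exists_inv_pow_mul_exp_le n hn hc0
  obtain ⟨K₃, hK₃, hK₃b⟩ := exists_one_add_pow_le_exp_sq 3 (show (0 : ℝ) < 1 / 2 by norm_num)
  have hP : 0 < ∏ i, x i := Finset.prod_pos fun i _ => hx i
  refine ⟨K₁ * (1 + m) ^ 3 * K₃ * (∏ i, x i) * K₂, by positivity, fun α hα η hη => ?_⟩
  set v := α⁻¹ with hv
  have hv0 : 0 < v := by positivity
  set t : ℝ := |η - m| * v with ht
  have ht0 : 0 ≤ t := by positivity
  have ht2 : t ^ 2 = (η - m) ^ 2 * v ^ 2 := by rw [ht, mul_pow, sq_abs]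
  have hs : 1 + η / α ≤ (1 + m) * (1 + v) * (1 + t) := by
    have h1 : η * v ≤ m * v + t := by
      rw [ht, ← add_mul]
      gcongr
      linarith [le_abs_self (η - m)]
    rw [div_eq_mul_inv]
    have := mul_nonneg hm0.le hv0.le
    have := mul_nonneg hm0.le ht0
    have := mul_nonneg hv0.le ht0
    have := mul_nonneg (mul_nonneg hm0.le hv0.le) ht0
    nlinarith
  have hsqrt : √((η ^ 2 / α ^ 2 + 1) * PsiRice (η ^ 2 / α ^ 2) - η ^ 2 / α ^ 2) ≤
      K₁ * ((1 + m) ^ 3 * (1 + v) ^ 3 * (K₃ * Real.exp (1 / 2 * t ^ 2))) := by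
    rw [← div_pow]
    refine (hK₁b _ (by positivity)).trans ?_
    gcongr
    calc (1 + η / α) ^ 3 ≤ ((1 + m) * (1 + v) * (1 + t)) ^ 3 := by gcongr
      _ = (1 + m) ^ 3 * (1 + v) ^ 3 * (1 + t) ^ 3 := by ring
      _ ≤ _ := by gcongr; exact hK₃b t ht0
  have hexp : (∏ i, x i * besselI0 (η * x i / α ^ 2)) *
      Real.exp (-(∑ i, (x i ^ 2 + η ^ 2) / (2 * α ^ 2))) ≤
      (∏ i, x i) * (Real.exp (-(c * v ^ 2)) * Real.exp (-t ^ 2)) := by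
    refine (mul_le_mul_of_nonneg_right (prod_mul_besselI0_le hx hη)
      (Real.exp_pos _).le).trans ?_
    rw [mul_assoc, ← Real.exp_add, ← Real.exp_add]
    refine mul_le_mul_of_nonneg_left (Real.exp_le_exp.2 ?_) hP.le
    have e : ∑ i, η * x i / α ^ 2 + -(∑ i, (x i ^ 2 + η ^ 2) / (2 * α ^ 2)) =
        -((∑ k, (x k - η) ^ 2) * (v ^ 2 / 2)) := by
      rw [← sub_eq_add_neg, ← Finset.sum_sub_distrib, Finset.sum_mul, ← Finset.sum_neg_distrib]
      refine Finset.sum_congr rfl fun k _ => ?_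
      rw [hv]
      field_simp
      ring
    have h := mul_le_mul_of_nonneg_right (sum_sub_sq_ge x (fun h => hij (congrArg x h)) η)
      (show 0 ≤ v ^ 2 / 2 by positivity)
    rw [e, ht2, hc, hm]
    linarith
  have hI0 : 0 ≤ (∏ i, x i * besselI0 (η * x i / α ^ 2)) *
      Real.exp (-(∑ i, (x i ^ 2 + η ^ 2) / (2 * α ^ 2))) :=
    mul_nonneg (Finset.prod_nonneg fun i _ => mul_nonneg (hx i).le (besselI0_nonneg _))
      (Real.exp_pos _).le
  have hlast : Real.exp (-(1 / (2 * α ^ 2)) * (η - m) ^ 2) =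
      Real.exp (1 / 2 * t ^ 2) * Real.exp (-t ^ 2) := by
    rw [← Real.exp_add, ht2, hv]
    congr 1
    field_simp
    ring
  rw [mul_assoc, div_eq_mul_inv, ← inv_pow, hlast]
  calc _ ≤ K₁ * ((1 + m) ^ 3 * (1 + v) ^ 3 * (K₃ * Real.exp (1 / 2 * t ^ 2))) * v ^ (2 * n + 2) *
        ((∏ i, x i) * (Real.exp (-(c * v ^ 2)) * Real.exp (-t ^ 2))) := by gcongr
    _ = K₁ * (1 + m) ^ 3 * K₃ * (∏ i, x i) *
        ((1 + v) ^ 3 * v ^ (2 * n + 1) * Real.exp (-(c * v ^ 2))) * v *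
        (Real.exp (1 / 2 * t ^ 2) * Real.exp (-t ^ 2)) := by ring
    _ ≤ K₁ * (1 + m) ^ 3 * K₃ * (∏ i, x i) * (K₂ * (1 + α ^ 2)⁻¹) * v *
        (Real.exp (1 / 2 * t ^ 2) * Real.exp (-t ^ 2)) := by
      gcongr _ * ?_ * v * _
      exact hK₂b α hα
    _ = _ := by ring

lemma setLIntegral_gaussian_le {A : ℝ} (hA : 0 ≤ A) {α : ℝ} (hα : 0 < α) (m : ℝ) :
    ∫⁻ η in Ioi (0 : ℝ), ENNReal.ofReal
        (A * α⁻¹ * Real.exp (-(1 / (2 * α ^ 2)) * (η - m) ^ 2)) ≤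
      ENNReal.ofReal (A * √(2 * Real.pi)) := by
  have hb : 0 < 1 / (2 * α ^ 2) := by positivity
  refine (setLIntegral_le_lintegral _ _).trans ?_
  rw [← ofReal_integral_eq_lintegral_ofReal ((integrable_gaussian_shift hb m).const_mul _)
    (Eventually.of_forall fun η => by positivity), integral_const_mul, integral_gaussian_shift]
  refine (congrArg ENNReal.ofReal ?_).le
  have : √(Real.pi / (1 / (2 * α ^ 2))) = √(2 * Real.pi) * α := by
    rw [← Real.sqrt_sq hα.le, ← Real.sqrt_mul (by positivity), Real.sq_sqrt (by positivity)]
    congr 1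
    field_simp
  rw [this]
  field_simp

theorem stmt_7 (n : ℕ) (hn : 2 < n) (x : Fin n → ℝ) (hx : ∀ i, 0 < x i)
    (hne : ∃ i j, x i ≠ x j) :
    (∫⁻ α in Set.Ioi (0 : ℝ), ∫⁻ η in Set.Ioi (0 : ℝ),
      ENNReal.ofReal
        (Real.sqrt ((η ^ 2 / α ^ 2 + 1) * PsiRice (η ^ 2 / α ^ 2) - η ^ 2 / α ^ 2) /
            α ^ (2 * n + 2) *
          (∏ i, x i * besselI0 (η * x i / α ^ 2)) *
          Real.exp (-(∑ i, (x i ^ 2 + η ^ 2) / (2 * α ^ 2))))) < ⊤ := by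
  obtain ⟨i, j, hij⟩ := hne
  obtain ⟨K, hK, hKb⟩ := exists_posterior_le (by lia : 0 < n) hx hij
  have hint : Integrable fun α : ℝ => K * (1 + α ^ 2)⁻¹ * √(2 * Real.pi) :=
    (integrable_inv_one_add_sq.const_mul K).mul_const _
  refine lt_of_le_of_lt ?_ (hint.integrableOn (s := Ioi 0)).lintegral_lt_top
  refine setLIntegral_mono' measurableSet_Ioi fun α hα => ?_
  have hα : 0 < α := hα
  exact (setLIntegral_mono' measurableSet_Ioi fun η hη =>
    ENNReal.ofReal_le_ofReal (hKb α hα η hη)).trans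
      (setLIntegral_gaussian_le (by positivity) hα _)
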